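/- Consider the third round of the probabilistic conciliator, modeled as one no-equivocation round over messages of type Grade × V with well-behaved/impersonated structure, where the broadcast value of each well-behaved processor is its commit-adopt output (v q = ca q for q ∈ W), the commit-adopt outputs satisfy agreement (if ca q = (commit, w) for some q then (ca q').2 = w for every q'), and all processors obtain the same well-behaved leader l ∈ W. Suppose each processor p outputs as follows: (1) w if p receives (commit, w) from a strict majority; (2) otherwise, w if rcv p l = some (some (g, w)) for some grade g; (3) otherwise, in p. Then every processor outputs the same value. -/

import Mathlib

/-- The two-element type of commit-adopt grades. -/
inductive Grade : Type
  | commit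
  | adopt
deriving DecidableEq

/-- Third round of the probabilistic conciliator: if all processors obtain
the same well-behaved leader `l ∈ W`, then every processor outputs the same value. -/
theorem stmt_12 {P V : Type*}
    (rcv : P → P → Option (Option (Grade × V)))
    (hfin : ∀ p : P, {q | rcv p q ≠ none}.Finite)
    (noeq : ∀ p p' q : P, ∀ m m' : Grade × V,
      rcv p q = some (some m) → rcv p' q = some (some m') → m = m')
    (fnote : ∀ p p' q : P, ∀ m : Grade × V, rcv p q = some (some m) → rcv p' q ≠ none)
    (W F : Set P) (hWfin : W.Finite) (hFfin : F.Finite)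
    (hdisj : Disjoint W F) (hcard : F.ncard < W.ncard)
    (v : P → Grade × V)
    (hbcast : ∀ q ∈ W, ∀ p : P, rcv p q = some (some (v q)))
    (hheard : ∀ p q : P, rcv p q ≠ none → q ∈ W ∪ F)
    (ca : P → Grade × V) (inp : P → V)
    (hv : ∀ q ∈ W, v q = ca q)
    (hcaagr : ∀ (q q' : P) (w : V), ca q = (Grade.commit, w) → (ca q').2 = w)
    (l : P) (hl : l ∈ W)
    (out : P → V)
    (hout : ∀ p : P,
      (∃ w : V, 2 * {q | rcv p q = some (some (Grade.commit, w))}.ncard >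
          {q | rcv p q ≠ none}.ncard ∧ out p = w) ∨
      ((¬ ∃ w : V, 2 * {q | rcv p q = some (some (Grade.commit, w))}.ncard >
          {q | rcv p q ≠ none}.ncard) ∧
        (∃ (g : Grade) (w : V), rcv p l = some (some (g, w)) ∧ out p = w)) ∨
      ((¬ ∃ w : V, 2 * {q | rcv p q = some (some (Grade.commit, w))}.ncard >
          {q | rcv p q ≠ none}.ncard) ∧
        (¬ ∃ (g : Grade) (w : V), rcv p l = some (some (g, w))) ∧
        out p = inp p)) :
    ∀ p p' : P, out p = out p' := by
  have key : ∀ p : P, out p = (ca l).2 := by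
    intro p
    have hrl := hbcast l hl p
    rcases hout p with ⟨w, hw, ho⟩ | ⟨_, g, w, hw, ho⟩ | ⟨_, hn, _⟩
    · by_cases hex : ∃ q ∈ W, rcv p q = some (some (Grade.commit, w))
      · obtain ⟨q, hq, hr⟩ := hex
        rw [hbcast q hq p, hv q hq] at hr
        have hc : ca q = (Grade.commit, w) := by simpa using hr
        rw [ho, hcaagr q l w hc]
      · exfalso
        have hAF : {q | rcv p q = some (some (Grade.commit, w))} ⊆ F := by
          intro q hq
          have hq' : rcv p q = some (some (Grade.commit, w)) := hq
          rcases hheard p q (by simp [hq']) with h | h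
          · exact absurd ⟨q, h, hq'⟩ hex
          · exact h
        have hdis : Disjoint {q | rcv p q = some (some (Grade.commit, w))} W :=
          (hdisj.mono_right hAF).symm
        have h1 := Set.ncard_le_ncard hAF hFfin
        have h2 := Set.ncard_union_eq hdis (hFfin.subset hAF) hWfin
        have h3 : {q | rcv p q = some (some (Grade.commit, w))} ∪ W ⊆ {q | rcv p q ≠ none} := by
          rintro q (h | h)
          · have h' : rcv p q = some (some (Grade.commit, w)) := h
            simp [h']
          · simp [hbcast q h p]
        have h4 := Set.ncard_le_ncard h3 (hfin p)
        omega
    · rw [hrl, hv l hl] at hw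
      have hc : ca l = (g, w) := by simpa using hw
      rw [ho, hc]
    · exact absurd ⟨(v l).1, (v l).2, hrl⟩ hn
  intro p p'
  rw [key p, key p']
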